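/- arXiv:1602.08563 — 2 statements merged into one kernel-verified Lean document; each statement's English description precedes it below -/
import Mathlib

section
/- Given a negative field F^t of the algorithm TC, its corresponding changeset X_t, and a proper tree cap Y ⊆ X_t, it is possible to choose a leaf v of Y and legally shift some requests inside Y (keeping them in slots of F^t), so that afterwards the number of requests at v within F^t equals exactly α and Y \ {v} is proper. -/
open scoped Classical

/-!
Common setup for the online tree caching problem
(Bienkowski, Marcinkowski, Pacut, Schmid, Spyra, "Online Tree Caching").
-/

/-- A finite rooted tree on the vertex type `V`: every vertex has a parent,
the root is its own parent, and iterating `parent` from any vertex reaches the root. -/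
structure RTree (V : Type) where
  root : V
  parent : V → V
  parent_root : parent root = root
  reaches_root : ∀ v : V, ∃ n : ℕ, parent^[n] v = root

namespace RTree

variable {V : Type}

/-- The subtree `T(u)`: `u` together with all its descendants. -/
def subtree (T : RTree V) (u : V) : Set V :=
  {v | ∃ n : ℕ, T.parent^[n] v = u}

/-- `C` is a subforest of `T`: with every node it contains the whole subtree below it. -/
def Subforest (T : RTree V) (C : Set V) : Prop :=
  ∀ v ∈ C, T.subtree v ⊆ C

/-- `A` is a tree cap rooted at `v`: `A ⊆ T(v)`, `v ∈ A`, and `A` is closed under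
taking the parent (towards `v`). -/
def TreeCap (T : RTree V) (v : V) (A : Set V) : Prop :=
  A ⊆ T.subtree v ∧ v ∈ A ∧ ∀ u ∈ A, u ≠ v → T.parent u ∈ A

/-- `X` is a valid positive changeset for the cache `C`. -/
def ValidPos (T : RTree V) (C X : Set V) : Prop :=
  X.Nonempty ∧ X ∩ C = ∅ ∧ T.Subforest (C ∪ X)

/-- `X` is a valid negative changeset for the cache `C`. -/
def ValidNeg (T : RTree V) (C X : Set V) : Prop :=
  X.Nonempty ∧ X ⊆ C ∧ T.Subforest (C \ X)

/-- `X` is a valid changeset for the cache `C`. -/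
def Valid (T : RTree V) (C X : Set V) : Prop :=
  T.ValidPos C X ∨ T.ValidNeg C X

/-- `w` is the root of a tree (connected component) of the subforest `C`. -/
def IsCompRoot (T : RTree V) (C : Set V) (w : V) : Prop :=
  w ∈ C ∧ (w = T.root ∨ T.parent w ∉ C)

/-- The depth of a node: its distance to the root. -/
noncomputable def depth [DecidableEq V] (T : RTree V) (v : V) : ℕ :=
  Nat.find (T.reaches_root v)

/-- The height `h(T)` of the tree: its number of levels. -/
noncomputable def height [Fintype V] [DecidableEq V] (T : RTree V) : ℕ :=
  (Finset.univ.sup fun v => T.depth v) + 1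

end RTree

/-- A request: a node together with a sign (`true` = positive, `false` = negative). -/
abbrev Request (V : Type) := V × Bool

/-- The request `r` incurs cost `1` when the cache is `C`
(a positive request to a non-cached node, or a negative request to a cached node). -/
def Costly {V : Type} (r : Request V) (C : Set V) : Prop :=
  (r.2 = true ∧ r.1 ∉ C) ∨ (r.2 = false ∧ r.1 ∈ C)

/-- The sum of the counters `f` over the set of nodes `A`. -/
noncomputable def cntSum {V : Type} [Fintype V] (f : V → ℕ) (A : Set V) : ℕ :=
  ∑ v : V, A.indicator f v

/-- The number of nodes of a changeset (`0` for no changeset). -/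
noncomputable def chgSize {V : Type} : Option (Set V) → ℕ
  | none => 0
  | some X => X.ncard

/-- One phase of the algorithm `TC` on the request sequence `req` (the request of
round `t ≥ 1` is `req t`), starting at time `0` with an empty cache.
`cache t` is the cache contents during round `t`; `cnt t` are the counter values just
after serving the request of round `t` (used for the decision at time `t`);
`chg t` is the changeset applied at time `t` (right after round `t`), if any. -/
structure TCPhase {V : Type} [Fintype V] [DecidableEq V]
    (T : RTree V) (α : ℕ) (req : ℕ → Request V) where
  cache : ℕ → Set V
  cnt : ℕ → V → ℕ
  chg : ℕ → Option (Set V)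
  cache_subforest : ∀ t, T.Subforest (cache t)
  cache_zero : cache 0 = ∅
  cnt_zero : ∀ v, cnt 0 v = 0
  cnt_rec : ∀ t v, cnt (t + 1) v =
    (if ∃ X, chg t = some X ∧ v ∈ X then 0 else cnt t v)
    + (if (req (t + 1)).1 = v ∧ Costly (req (t + 1)) (cache (t + 1)) then 1 else 0)
  step_some : ∀ t X, chg t = some X →
    T.Valid (cache t) X ∧
    X.ncard * α ≤ cntSum (cnt t) X ∧
    (∀ Y, T.Valid (cache t) Y → X ⊂ Y → cntSum (cnt t) Y < Y.ncard * α) ∧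
    cache (t + 1) = if T.ValidPos (cache t) X then cache t ∪ X else cache t \ X
  step_none : ∀ t, chg t = none →
    cache (t + 1) = cache t ∧
    ∀ X, T.Valid (cache t) X → cntSum (cnt t) X < X.ncard * α

namespace TCPhase

variable {V : Type} [Fintype V] [DecidableEq V]
  {T : RTree V} {α : ℕ} {req : ℕ → Request V}

/-- The counter values at time `t`, right after the cache change at time `t`
(counters of fetched/evicted nodes are reset to `0`). -/
noncomputable def cntPost (E : TCPhase T α req) (t : ℕ) (v : V) : ℕ :=
  if ∃ X, E.chg t = some X ∧ v ∈ X then 0 else E.cnt t v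

/-- `last_v(t)`: the last time strictly before `t` at which `v` changed its
cached/non-cached state (`0`, the beginning of the phase, if there is none). -/
noncomputable def lastChg (E : TCPhase T α req) (v : V) (t : ℕ) : ℕ :=
  ((Finset.range t).filter fun s => ¬ ((v ∈ E.cache s) ↔ v ∈ E.cache (s + 1))).sup id

/-- The slot `(v, r)` belongs to the field `F^t`. -/
def inField (E : TCPhase T α req) (t : ℕ) (v : V) (r : ℕ) : Prop :=
  ∃ X, E.chg t = some X ∧ v ∈ X ∧ E.lastChg v t < r ∧ r ≤ t

/-- The number of requests of the sequence `ρ` lying in slots of `F^t_{≤ τ} ∩ D`. -/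
noncomputable def fieldReqIn (E : TCPhase T α req) (ρ : ℕ → Request V)
    (t : ℕ) (D : Set V) (τ : ℕ) : ℕ :=
  ((Finset.Icc 1 t).filter fun r => r ≤ τ ∧ (ρ r).1 ∈ D ∧ E.inField t (ρ r).1 r).card

/-- `req(F^t)`: the number of requests of `ρ` in slots of the field `F^t`. -/
noncomputable def fieldReq (E : TCPhase T α req) (ρ : ℕ → Request V) (t : ℕ) : ℕ :=
  E.fieldReqIn ρ t Set.univ t

/-- `size(F^t_{≤ τ} ∩ D)`: the number of distinct nodes having a slot in `F^t_{≤ τ} ∩ D`. -/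
noncomputable def fieldSizeIn (E : TCPhase T α req) (t : ℕ) (D : Set V) (τ : ℕ) : ℕ :=
  (Finset.univ.filter fun v : V => v ∈ D ∧ ∃ r, r ≤ τ ∧ E.inField t v r).card

/-- The standing assumption: no positive requests are given to cached nodes and no
negative requests to non-cached ones (so every request incurs cost `1` for `TC`). -/
def GoodReq (E : TCPhase T α req) : Prop :=
  ∀ t, 1 ≤ t →
    ((req t).2 = true → (req t).1 ∉ E.cache t) ∧
    ((req t).2 = false → (req t).1 ∈ E.cache t)

/-- The phase consists of rounds `1, …, tEnd`: no cache of `TC` before time `tEnd`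
exceeds the capacity `kONL` (at time `tEnd` the triggered fetch, if any, is performed
even if it exceeds the capacity, and is followed by the final eviction). -/
def PhaseEnd (E : TCPhase T α req) (kONL tEnd : ℕ) : Prop :=
  ∀ t, t < tEnd → (E.cache (t + 1)).ncard ≤ kONL

/-- `k_P`: the number of nodes in `TC`'s cache at the end of the phase
(after the fetch at time `tEnd`, before the final eviction). -/
noncomputable def kP (E : TCPhase T α req) (tEnd : ℕ) : ℕ :=
  (E.cache (tEnd + 1)).ncard

/-- The phase ending at `tEnd` is finished: the fetch at time `tEnd` exceeded the
capacity `kONL`. -/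
def FinishedAt (E : TCPhase T α req) (kONL tEnd : ℕ) : Prop :=
  E.PhaseEnd kONL tEnd ∧ kONL < E.kP tEnd

/-- `size(𝓕)`: the total size of all fields of the phase. -/
noncomputable def sizeFields (E : TCPhase T α req) (tEnd : ℕ) : ℕ :=
  ∑ t ∈ Finset.Icc 1 tEnd, chgSize (E.chg t)

/-- `req(F^∞)`: the number of requests of the phase lying in slots of the open field
(slots covered by no field of the phase). -/
noncomputable def openReq (E : TCPhase T α req) (tEnd : ℕ) : ℕ :=
  ((Finset.Icc 1 tEnd).filter fun r => ∀ t, t ≤ tEnd → ¬ E.inField t (req r).1 r).card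

/-- `TC(P)`: the total cost paid by `TC` during the phase: serving the requests,
fetching/evicting the applied changesets (`α` per node), and the final eviction
(`α · k_P`) if the phase is finished. -/
noncomputable def tcCost (E : TCPhase T α req) (kONL tEnd : ℕ) : ℕ :=
  ((Finset.Icc 1 tEnd).filter fun r => Costly (req r) (E.cache r)).card
  + α * E.sizeFields tEnd
  + (if kONL < E.kP tEnd then α * E.kP tEnd else 0)

/-- The tree cap `Y` (rooted at `u`, inside the negative field `F^t`) is proper for
the request sequence `ρ`: it holds `req(F^t ∩ Y) = |Y| · α`, and `F^t_{≤ τ} ∩ D` is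
not over-requested for every tree cap `D ⊆ Y` rooted at `u` and every time `τ ≤ t`. -/
def Proper (E : TCPhase T α req) (ρ : ℕ → Request V) (t : ℕ) (u : V) (Y : Set V) : Prop :=
  E.fieldReqIn ρ t Y t = Y.ncard * α ∧
  ∀ (D : Set V) (τ : ℕ), T.TreeCap u D → D ⊆ Y → τ ≤ t →
    E.fieldReqIn ρ t D τ ≤ E.fieldSizeIn t D τ * α

end TCPhase

/-- `D` is a feasible cache schedule for an (offline) algorithm with cache size `k`:
at every time the cache is a subforest of `T` of at most `k` nodes. -/
def IsSchedule {V : Type} (T : RTree V) (k : ℕ) (D : ℕ → Set V) : Prop :=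
  ∀ t, T.Subforest (D t) ∧ (D t).ncard ≤ k

/-- The cost of serving the requests of rounds `a, …, b` of `ρ` when the cache during
round `r` is `D r`. -/
noncomputable def serveCost {V : Type} (ρ : ℕ → Request V) (D : ℕ → Set V) (a b : ℕ) : ℕ :=
  ((Finset.Icc a b).filter fun r => Costly (ρ r) (D r)).card

/-- The reorganization cost of the schedule `D` (`α` per fetched or evicted node) over
the times `a, …, b - 1` (the change at time `t` leads from `D t` to `D (t+1)`). -/
noncomputable def moveCost {V : Type} (α : ℕ) (D : ℕ → Set V) (a b : ℕ) : ℕ :=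
  α * ∑ t ∈ Finset.Ico a b, ((D (t + 1) \ D t).ncard + (D t \ D (t + 1)).ncard)

/-- `OPT`: the minimum cost of serving rounds `a, …, b` of `ρ` by an offline algorithm
with cache size `k` that may start with an arbitrary cache. -/
noncomputable def optCostFrom {V : Type} (T : RTree V) (α k : ℕ)
    (ρ : ℕ → Request V) (a b : ℕ) : ℕ :=
  sInf {n | ∃ D : ℕ → Set V, IsSchedule T k D ∧
    n = serveCost ρ D a b + moveCost α D a b}

/-- `OPT`: the minimum cost of serving rounds `1, …, b` of `ρ` by an offline algorithm
with cache size `k` that starts with the empty cache. -/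
noncomputable def optCostEmpty {V : Type} (T : RTree V) (α k : ℕ)
    (ρ : ℕ → Request V) (b : ℕ) : ℕ :=
  sInf {n | ∃ D : ℕ → Set V, IsSchedule T k D ∧ D 0 = ∅ ∧
    n = serveCost ρ D 1 b + moveCost α D 0 b}

/-- `ρ'` is obtained from `ρ` by legally shifting requests: signs are preserved, every
positive request is moved to a descendant of its node (or kept), and every negative
request is moved to an ancestor of its node (or kept). -/
def LegalShift {V : Type} (T : RTree V) (ρ ρ' : ℕ → Request V) : Prop :=
  ∀ t, (ρ' t).2 = (ρ t).2 ∧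
    ((ρ t).2 = true → (ρ' t).1 ∈ T.subtree (ρ t).1) ∧
    ((ρ t).2 = false → (ρ t).1 ∈ T.subtree (ρ' t).1)

/-- A full run of the algorithm `TC` with cache capacity `kONL` on the request
sequence `req`, including phase restarts: whenever the fetch of a saturated changeset
would exceed the capacity, `TC` instead evicts its whole cache and a new phase starts
(`newPhase t` holds, and all counters are reset). -/
structure TCRun {V : Type} [Fintype V] [DecidableEq V]
    (T : RTree V) (α kONL : ℕ) (req : ℕ → Request V) where
  cache : ℕ → Set V
  cnt : ℕ → V → ℕ
  chg : ℕ → Option (Set V)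
  newPhase : ℕ → Prop
  cache_subforest : ∀ t, T.Subforest (cache t)
  cache_zero : cache 0 = ∅
  cnt_zero : ∀ v, cnt 0 v = 0
  capacity : ∀ t, (cache t).ncard ≤ kONL
  cnt_rec : ∀ t v, cnt (t + 1) v =
    (if newPhase t ∨ ∃ X, chg t = some X ∧ v ∈ X then 0 else cnt t v)
    + (if (req (t + 1)).1 = v ∧ Costly (req (t + 1)) (cache (t + 1)) then 1 else 0)
  step_some : ∀ t X, chg t = some X →
    T.Valid (cache t) X ∧
    X.ncard * α ≤ cntSum (cnt t) X ∧
    (∀ Y, T.Valid (cache t) Y → X ⊂ Y → cntSum (cnt t) Y < Y.ncard * α) ∧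
    ((T.ValidPos (cache t) X ∧ (cache t ∪ X).ncard ≤ kONL ∧
        cache (t + 1) = cache t ∪ X ∧ ¬ newPhase t) ∨
     (T.ValidPos (cache t) X ∧ kONL < (cache t ∪ X).ncard ∧
        cache (t + 1) = ∅ ∧ newPhase t) ∨
     (T.ValidNeg (cache t) X ∧ cache (t + 1) = cache t \ X ∧ ¬ newPhase t))
  step_none : ∀ t, chg t = none →
    cache (t + 1) = cache t ∧ ¬ newPhase t ∧
    ∀ X, T.Valid (cache t) X → cntSum (cnt t) X < X.ncard * α

/-- `TC(I)`: the total cost paid by the run `E` of `TC` on the rounds `1, …, N`: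
serving the requests, plus `α` per fetched/evicted node (on a phase restart the whole
cache is evicted). -/
noncomputable def TCRun.cost {V : Type} [Fintype V] [DecidableEq V]
    {T : RTree V} {α kONL : ℕ} {req : ℕ → Request V}
    (E : TCRun T α kONL req) (N : ℕ) : ℕ :=
  ((Finset.Icc 1 N).filter fun r => Costly (req r) (E.cache r)).card
  + α * ∑ t ∈ Finset.Icc 1 N,
      (if E.newPhase t then (E.cache t).ncard else chgSize (E.chg t))

/-- A finite set of naturals with at least `n` elements has an initial segment of `n` elements. -/
theorem Finset.exists_initial_subset_card (S : Finset ℕ) :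
    ∀ n ≤ S.card, ∃ K ⊆ S, K.card = n ∧ ∀ k ∈ K, ∀ r ∈ S \ K, k < r := by
  induction S using Finset.induction_on_max with
  | empty => exact fun n hn => ⟨∅, subset_rfl, (Nat.le_zero.1 hn).symm, by simp⟩
  | insert a s ha ih =>
    intro n hn
    have has : a ∉ s := fun h => lt_irrefl _ (ha a h)
    rw [Finset.card_insert_of_notMem has] at hn
    rcases Nat.lt_or_ge s.card n with h | h
    · refine ⟨insert a s, subset_rfl, ?_, by simp⟩
      rw [Finset.card_insert_of_notMem has]
      omega
    · obtain ⟨K, hKs, hK, hlt⟩ := ih n h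
      refine ⟨K, hKs.trans (Finset.subset_insert a s), hK, fun k hk r hr => ?_⟩
      rw [Finset.mem_sdiff, Finset.mem_insert] at hr
      rcases hr with ⟨rfl | hr, hrK⟩
      · exact ha k (hKs hk)
      · exact hlt k hk r (Finset.mem_sdiff.2 ⟨hr, hrK⟩)

namespace RTree

variable {V : Type} {T : RTree V} {u v p w : V} {Y D : Set V}

theorem mem_subtree_self (T : RTree V) (v : V) : v ∈ T.subtree v := ⟨0, rfl⟩

theorem mem_subtree_parent (h : v ∈ T.subtree w) : v ∈ T.subtree (T.parent w) := by
  obtain ⟨n, rfl⟩ := h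
  exact ⟨n + 1, Function.iterate_succ_apply' T.parent n v⟩

theorem parent_mem_subtree (h : v ∈ T.subtree w) (hne : w ≠ v) : T.parent v ∈ T.subtree w := by
  obtain ⟨n, rfl⟩ := h
  cases n with
  | zero => exact absurd rfl hne
  | succ n => exact ⟨n, rfl⟩

theorem eq_of_mem_subtree_of_parent_eq (h : v ∈ T.subtree w) (hp : T.parent v = v) : w = v := by
  obtain ⟨n, rfl⟩ := h
  exact Function.iterate_fixed hp n

theorem depth_parent_lt [DecidableEq V] (h : T.parent w ≠ w) :
    T.depth (T.parent w) < T.depth w := by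
  have hspec : T.parent^[T.depth w] w = T.root := Nat.find_spec (T.reaches_root w)
  cases hd : T.depth w with
  | zero =>
    rw [hd] at hspec
    change w = T.root at hspec
    rw [hspec] at h
    exact absurd T.parent_root h
  | succ n =>
    rw [hd] at hspec
    exact Nat.lt_succ_of_le (Nat.find_min' (T.reaches_root _) hspec)

theorem exists_leaf [Finite V] [DecidableEq V] (T : RTree V) (hY : Y.Nonempty) :
    ∃ v ∈ Y, ∀ w ∈ Y, w ≠ v → T.parent w ≠ v := by
  obtain ⟨v, hv, hmax⟩ := Set.exists_max_image Y T.depth Y.toFinite hY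
  refine ⟨v, hv, fun w hw hne hp => ?_⟩
  have hlt : T.depth (T.parent w) < T.depth w := depth_parent_lt (by rw [hp]; exact hne.symm)
  rw [hp] at hlt
  exact absurd (hmax w hw) (not_le.2 hlt)

theorem TreeCap.eq_singleton (hY : T.TreeCap u Y)
    (hleaf : ∀ w ∈ Y, w ≠ u → T.parent w ≠ u) : Y = {u} := by
  have key : ∀ n : ℕ, ∀ y ∈ Y, T.parent^[n] y = u → y = u := by
    intro n
    induction n with
    | zero => exact fun y _ h => h
    | succ n ih =>
      intro y hy h
      by_contra hne
      exact hleaf y hy hne (ih _ (hY.2.2 y hy hne) h)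
  refine Set.eq_singleton_iff_unique_mem.2 ⟨hY.2.1, fun y hy => ?_⟩
  obtain ⟨n, hn⟩ := hY.1 hy
  exact key n y hy hn

theorem TreeCap.diff_leaf (hY : T.TreeCap u Y) (hvu : v ≠ u)
    (hleaf : ∀ w ∈ Y, w ≠ v → T.parent w ≠ v) : T.TreeCap u (Y \ {v}) :=
  ⟨Set.sdiff_subset.trans hY.1, ⟨hY.2.1, hvu.symm⟩,
    fun w hw hwu => ⟨hY.2.2 w hw.1 hwu, hleaf w hw.1 hw.2⟩⟩

theorem TreeCap.insert (hD : T.TreeCap u D) (hv : T.parent v ∈ D) (hvu : v ∈ T.subtree u) :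
    T.TreeCap u (insert v D) := by
  refine ⟨Set.insert_subset hvu hD.1, Or.inr hD.2.1, ?_⟩
  rintro w (rfl | hw) hwu
  · exact Or.inr hv
  · exact Or.inr (hD.2.2 w hw hwu)

/-- The path from `u` to `v` is a tree cap. -/
theorem TreeCap.path (hY : T.TreeCap u Y) (hv : v ∈ Y) :
    T.TreeCap u {w | w ∈ Y ∧ v ∈ T.subtree w} :=
  ⟨fun _ hw => hY.1 hw.1, ⟨hY.2.1, hY.1 hv⟩,
    fun w hw hwu => ⟨hY.2.2 w hw.1 hwu, mem_subtree_parent hw.2⟩⟩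

end RTree

namespace TCPhase

variable {V : Type} [Fintype V] [DecidableEq V]
  {T : RTree V} {α : ℕ} {req : ℕ → Request V}

theorem mem_cache_of_lastChg_lt (E : TCPhase T α req) {w : V} {t s : ℕ}
    (hw : w ∈ E.cache t) (hs : E.lastChg w t < s) (hst : s ≤ t) : w ∈ E.cache s := by
  induction hst using Nat.decreasingInduction with
  | self => exact hw
  | of_succ k hk ih =>
    by_contra hcon
    have hmem := ih (hs.trans k.lt_succ_self)
    have hle : k ≤ E.lastChg w t := by
      refine Finset.le_sup (f := id) (Finset.mem_filter.2 ⟨Finset.mem_range.2 hk, ?_⟩)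
      exact fun h => hcon (h.2 hmem)
    omega

/-- For nodes cached at time `t`, descendants have changed their state no later than ancestors. -/
theorem lastChg_le_of_mem_subtree (E : TCPhase T α req) {v w : V} {t : ℕ}
    (hvw : v ∈ T.subtree w) (hw : w ∈ E.cache t) : E.lastChg v t ≤ E.lastChg w t := by
  refine Finset.sup_le fun s hs => ?_
  rw [Finset.mem_filter, Finset.mem_range] at hs
  by_contra hlt
  rw [id, not_le] at hlt
  refine hs.2 ⟨fun _ => ?_, fun _ => ?_⟩
  · exact E.cache_subforest _ w
      (E.mem_cache_of_lastChg_lt hw (hlt.trans s.lt_succ_self) hs.1) hvw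
  · exact E.cache_subforest _ w (E.mem_cache_of_lastChg_lt hw hlt hs.1.le) hvw

theorem inField_iff (E : TCPhase T α req) {t : ℕ} {X : Set V} (hchg : E.chg t = some X)
    {v : V} (hv : v ∈ X) {r : ℕ} : E.inField t v r ↔ E.lastChg v t < r ∧ r ≤ t := by
  constructor
  · rintro ⟨_, _, _, h⟩
    exact h
  · exact fun h => ⟨X, hchg, hv, h⟩

theorem fieldSizeIn_le_ncard (E : TCPhase T α req) (t : ℕ) (D : Set V) (τ : ℕ) :
    E.fieldSizeIn t D τ ≤ D.ncard := by
  rw [fieldSizeIn, ← Set.ncard_coe_finset]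
  exact Set.ncard_le_ncard (fun w hw => (Finset.mem_filter.1 hw).2.1) D.toFinite

theorem fieldSizeIn_insert_le (E : TCPhase T α req) (t : ℕ) (v : V) (D : Set V) (τ : ℕ) :
    E.fieldSizeIn t (insert v D) τ ≤ E.fieldSizeIn t D τ + 1 := by
  unfold fieldSizeIn
  refine (Finset.card_le_card ?_).trans (Finset.card_insert_le v _)
  intro w hw
  simp only [Finset.mem_filter, Finset.mem_insert, Finset.mem_univ, true_and,
    Set.mem_insert_iff] at hw ⊢
  tauto

theorem fieldReqIn_mono (E : TCPhase T α req) (ρ : ℕ → Request V) (t : ℕ) {D D' : Set V}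
    (h : D ⊆ D') (τ : ℕ) : E.fieldReqIn ρ t D τ ≤ E.fieldReqIn ρ t D' τ :=
  Finset.card_le_card fun r hr => by
    rw [Finset.mem_filter] at hr ⊢
    exact ⟨hr.1, hr.2.1, h hr.2.2.1, hr.2.2.2⟩

/-- If the leaf `v` of a proper tree cap carries more than `α` requests up to time `r`, then
the slot of its parent at time `r` belongs to the field. -/
theorem Proper.inField_parent {E : TCPhase T α req} {t : ℕ} {X : Set V}
    (hchg : E.chg t = some X) (hXC : X ⊆ E.cache t) {u v : V} {Y : Set V}
    (hYcap : T.TreeCap u Y) (hYX : Y ⊆ X) (hprop : E.Proper req t u Y) (hv : v ∈ Y)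
    (hp : T.parent v ∈ Y) {r : ℕ} (hrt : r ≤ t) (hr : α < E.fieldReqIn req t {v} r) :
    E.inField t (T.parent v) r := by
  rw [E.inField_iff hchg (hYX hp)]
  refine ⟨?_, hrt⟩
  by_contra! hle
  obtain ⟨P, hPcap, hP⟩ : ∃ P, T.TreeCap u P ∧ ∀ w, w ∈ P ↔ w ∈ Y ∧ v ∈ T.subtree w :=
    ⟨_, hYcap.path hv, fun _ => Iff.rfl⟩
  have hpath := hprop.2 P r hPcap (fun w hw => ((hP w).1 hw).1) hrt
  have hreq := E.fieldReqIn_mono req t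
    (Set.singleton_subset_iff.2 ((hP v).2 ⟨hv, T.mem_subtree_self v⟩)) r
  have hsize : E.fieldSizeIn t P r ≤ 1 := by
    rw [fieldSizeIn, ← Finset.card_singleton v]
    refine Finset.card_le_card fun w hw => ?_
    obtain ⟨-, hwP, s, hsr, hs⟩ := Finset.mem_filter.1 hw
    obtain ⟨hwY, hvw⟩ := (hP w).1 hwP
    rw [Finset.mem_singleton]
    by_contra hne
    have hmono := E.lastChg_le_of_mem_subtree (RTree.parent_mem_subtree hvw hne) (hXC (hYX hwY))
    have := ((E.inField_iff hchg (hYX hwY)).1 hs).1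
    omega
  have := Nat.mul_le_mul_right α hsize
  omega

end TCPhase

/-- given a negative field `F^t` with changeset `X_t` and a proper tree
cap `Y ⊆ X_t` (rooted at `u`), one can choose a leaf `v` of `Y` and legally shift some
requests up inside `Y`, keeping them within the slots of `F^t`, so that afterwards `v`
carries exactly `α` requests within `F^t` and `Y \ {v}` is proper. -/
theorem shift_up_and_stay_proper {V : Type} [Fintype V] [DecidableEq V]
    {T : RTree V} {α : ℕ} {req : ℕ → Request V}
    (E : TCPhase T α req) (hα : 1 ≤ α) (hgood : E.GoodReq)
    (t : ℕ) (X : Set V) (hchg : E.chg t = some X) (hneg : T.ValidNeg (E.cache t) X)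
    (u : V) (Y : Set V) (hYcap : T.TreeCap u Y) (hYX : Y ⊆ X)
    (hprop : E.Proper req t u Y) :
    ∃ (v : V) (ρ' : ℕ → Request V),
      v ∈ Y ∧ (∀ w ∈ Y, w ≠ v → T.parent w ≠ v) ∧
      (∀ r, (ρ' r).2 = (req r).2) ∧
      (∀ r, ρ' r ≠ req r →
        (req r).1 ∈ Y ∧ E.inField t (req r).1 r ∧
        (ρ' r).1 ∈ Y ∧ (req r).1 ∈ T.subtree (ρ' r).1 ∧ E.inField t (ρ' r).1 r) ∧
      E.fieldReqIn ρ' t {v} t = α ∧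
      E.Proper ρ' t u (Y \ {v}) := by
  obtain ⟨v, hvY, hleaf⟩ := T.exists_leaf ⟨u, hYcap.2.1⟩
  by_cases hvu : v = u
  · subst hvu
    obtain rfl := hYcap.eq_singleton hleaf
    refine ⟨v, req, hvY, hleaf, fun _ => rfl, fun r h => absurd rfl h, ?_, ?_, ?_⟩
    · simpa using hprop.1
    · simp [TCPhase.fieldReqIn]
    · exact fun D τ hD hsub => absurd rfl (hsub hD.2.1).2
  have hpY : T.parent v ∈ Y := hYcap.2.2 v hvY hvu
  have hpv : T.parent v ≠ v := fun h =>
    hvu (RTree.eq_of_mem_subtree_of_parent_eq (hYcap.1 hvY) h).symm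
  set S := (Finset.Icc 1 t).filter fun r => (req r).1 = v ∧ E.inField t v r with hS
  have memS (r : ℕ) : r ∈ S ↔ (1 ≤ r ∧ r ≤ t) ∧ (req r).1 = v ∧ E.inField t v r := by
    rw [hS, Finset.mem_filter, Finset.mem_Icc]
  have hcardS (τ : ℕ) : E.fieldReqIn req t {v} τ = (S.filter (· ≤ τ)).card := by
    unfold TCPhase.fieldReqIn
    congr 1
    ext r
    simp only [Finset.mem_filter, Finset.mem_Icc, memS, Set.mem_singleton_iff]
    constructor
    · rintro ⟨h1, h2, rfl, h4⟩
      exact ⟨⟨h1, rfl, h4⟩, h2⟩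
    · rintro ⟨⟨h1, rfl, h4⟩, h2⟩
      exact ⟨h1, h2, rfl, h4⟩
  have hncard : (Y \ {v}).ncard + 1 = Y.ncard := Set.ncard_sdiff_singleton_add_one hvY Y.toFinite
  have hSα : α ≤ S.card := by
    have h1 := hprop.2 _ t (hYcap.diff_leaf hvu hleaf) Set.sdiff_subset le_rfl
    have h2 := Nat.mul_le_mul_right α (E.fieldSizeIn_le_ncard t (Y \ {v}) t)
    have h3 : E.fieldReqIn req t Y t ≤ E.fieldReqIn req t (Y \ {v}) t + S.card := by
      unfold TCPhase.fieldReqIn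
      refine (Finset.card_le_card fun r hr => ?_).trans (Finset.card_union_le _ _)
      simp only [Finset.mem_filter, Finset.mem_Icc, Finset.mem_union, memS, Set.mem_sdiff,
        Set.mem_singleton_iff] at hr ⊢
      by_cases h : (req r).1 = v
      · exact Or.inr ⟨hr.1, h, h ▸ hr.2.2.2⟩
      · exact Or.inl ⟨hr.1, hr.2.1, ⟨hr.2.2.1, h⟩, hr.2.2.2⟩
    rw [hprop.1, ← hncard, add_mul, one_mul] at h3
    omega
  obtain ⟨K, hKS, hK, hlt⟩ := S.exists_initial_subset_card α hSα
  have hfield : ∀ r ∈ S \ K, E.inField t (T.parent v) r := by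
    intro r hr
    obtain ⟨hrS, hrK⟩ := Finset.mem_sdiff.1 hr
    refine hprop.inField_parent hchg hneg.2.1 hYcap hYX hvY hpY ((memS r).1 hrS).1.2 ?_
    rw [hcardS, ← hK]
    refine Finset.card_lt_card ⟨fun k hk => ?_, fun h => hrK (h ?_)⟩
    · exact Finset.mem_filter.2 ⟨hKS hk, (hlt k hk r hr).le⟩
    · exact Finset.mem_filter.2 ⟨hrS, le_rfl⟩
  set ρ : ℕ → Request V := fun r => if r ∈ S \ K then (T.parent v, (req r).2) else req r
  have hρ_pos {r : ℕ} (h : r ∈ S \ K) : ρ r = (T.parent v, (req r).2) := if_pos h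
  have hρ_neg {r : ℕ} (h : r ∉ S \ K) : ρ r = req r := if_neg h
  have hinsert (D : Set V) (τ : ℕ) (hvD : v ∉ D) (hpD : T.parent v ∈ D) :
      E.fieldReqIn ρ t D τ + (K.filter (· ≤ τ)).card = E.fieldReqIn req t (insert v D) τ := by
    unfold TCPhase.fieldReqIn
    rw [← Finset.card_union_of_disjoint]
    · congr 1
      ext r
      simp only [Finset.mem_union, Finset.mem_filter, Finset.mem_Icc, Set.mem_insert_iff]
      by_cases h : r ∈ S \ K
      · obtain ⟨hrS, hrK⟩ := Finset.mem_sdiff.1 h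
        obtain ⟨h1, h2, h3⟩ := (memS r).1 hrS
        rw [hρ_pos h, h2]
        have := hfield r h
        tauto
      · rw [hρ_neg h]
        by_cases hrK : r ∈ K
        · obtain ⟨h1, h2, h3⟩ := (memS r).1 (hKS hrK)
          rw [h2]
          tauto
        · have hrS : r ∉ S := fun hrS => h (Finset.mem_sdiff.2 ⟨hrS, hrK⟩)
          rw [memS] at hrS
          by_cases hv : (req r).1 = v
          · rw [hv]
            tauto
          · tauto
    · refine Finset.disjoint_left.2 fun r hr hrK => ?_
      have hrK' := (Finset.mem_filter.1 hrK).1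
      rw [Finset.mem_filter, hρ_neg fun h => (Finset.mem_sdiff.1 h).2 hrK',
        ((memS r).1 (hKS hrK')).2.1] at hr
      exact hvD hr.2.2.1
  refine ⟨v, ρ, hvY, hleaf, fun r => ?_, fun r hr => ?_, ?_, ?_, fun D τ hD hDY hτ => ?_⟩
  · by_cases h : r ∈ S \ K
    · rw [hρ_pos h]
    · rw [hρ_neg h]
  · have h : r ∈ S \ K := by
      by_contra h
      exact hr (hρ_neg h)
    obtain ⟨-, h2, h3⟩ := (memS r).1 (Finset.mem_sdiff.1 h).1
    rw [hρ_pos h, h2]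
    exact ⟨hvY, h3, hpY, RTree.mem_subtree_parent (T.mem_subtree_self v), hfield r h⟩
  · refine Eq.trans ?_ hK
    unfold TCPhase.fieldReqIn
    congr 1
    ext r
    simp only [Finset.mem_filter, Finset.mem_Icc, Set.mem_singleton_iff]
    by_cases h : r ∈ S \ K
    · rw [hρ_pos h]
      exact iff_of_false (fun hr => hpv hr.2.2.1) (Finset.mem_sdiff.1 h).2
    · rw [hρ_neg h]
      constructor
      · rintro ⟨h1, -, h3, h4⟩
        by_contra hrK
        exact h (Finset.mem_sdiff.2 ⟨(memS r).2 ⟨h1, h3, h3 ▸ h4⟩, hrK⟩)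
      · intro hrK
        obtain ⟨h1, h2, h3⟩ := (memS r).1 (hKS hrK)
        exact ⟨h1, h1.2, h2, h2.symm ▸ h3⟩
  · have h := hinsert (Y \ {v}) t (fun h => h.2 rfl) ⟨hpY, hpv⟩
    have hKt : K.filter (· ≤ t) = K :=
      Finset.filter_true_of_mem fun k hk => ((memS k).1 (hKS hk)).1.2
    rw [Set.insert_sdiff_singleton, Set.insert_eq_of_mem hvY, hprop.1, hKt, hK, ← hncard,
      add_mul, one_mul] at h
    omega
  · have hvD : v ∉ D := fun h => (hDY h).2 rfl
    have hDY' : D ⊆ Y := hDY.trans Set.sdiff_subset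
    by_cases hcase : T.parent v ∈ D ∧ ∃ r ∈ S \ K, r ≤ τ
    · obtain ⟨hpD, r, hr, hrτ⟩ := hcase
      have h := hinsert D τ hvD hpD
      have hKτ : K.filter (· ≤ τ) = K :=
        Finset.filter_true_of_mem fun k hk => (hlt k hk r hr).le.trans hrτ
      rw [hKτ, hK] at h
      have h1 := hprop.2 _ τ (hD.insert hpD (hYcap.1 hvY)) (Set.insert_subset hvY hDY') hτ
      have h2 := Nat.mul_le_mul_right α (E.fieldSizeIn_insert_le t v D τ)
      rw [add_mul, one_mul] at h2
      omega
    · refine le_trans (Finset.card_le_card fun r hr => ?_) (hprop.2 D τ hD hDY' hτ)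
      rw [Finset.mem_filter] at hr ⊢
      by_cases h : r ∈ S \ K
      · rw [hρ_pos h] at hr
        exact absurd ⟨hr.2.2.1, r, h, hr.2.1⟩ hcase
      · rwa [hρ_neg h] at hr
end

section
/- For any phase P of the algorithm TC, req(F^∞) ≤ 2·k_ONL·α + 2·OPT(P), where req(F^∞) is the number of requests of P lying in slots of the open field F^∞ and OPT(P) is the minimum cost of serving the requests of P by an offline algorithm with cache size k_OPT that may start the phase with an arbitrary cache. -/
open scoped Classical

namespace RTree

variable {V : Type} {T : RTree V}

theorem Subforest.union {C D : Set V} (hC : T.Subforest C) (hD : T.Subforest D) :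
    T.Subforest (C ∪ D) := by
  rintro v (hv | hv)
  · exact (hC v hv).trans Set.subset_union_left
  · exact (hD v hv).trans Set.subset_union_right

theorem Subforest.inter {C D : Set V} (hC : T.Subforest C) (hD : T.Subforest D) :
    T.Subforest (C ∩ D) := fun v hv =>
  Set.subset_inter (hC v hv.1) (hD v hv.2)

theorem Subforest.biUnion {ι : Type} {s : Set ι} {D : ι → Set V}
    (hD : ∀ i ∈ s, T.Subforest (D i)) : T.Subforest (⋃ i ∈ s, D i) := by
  intro v hv
  obtain ⟨i, hi, hvi⟩ := Set.mem_iUnion₂.1 hv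
  exact (hD i hi v hvi).trans (Set.subset_biUnion_of_mem hi)

theorem Valid.nonempty {C X : Set V} (h : T.Valid C X) : X.Nonempty :=
  h.elim (fun h => h.1) (fun h => h.1)

theorem Valid.ncard_mul_pos [Finite V] {C X : Set V} (hX : T.Valid C X) {α : ℕ}
    (hα : 1 ≤ α) : 0 < X.ncard * α :=
  Nat.mul_pos ((Set.ncard_pos (Set.toFinite X)).2 hX.nonempty) hα

theorem ValidPos.union {C X Y : Set V} (hX : T.ValidPos C X) (hY : T.ValidPos (C ∪ X) Y) :
    T.ValidPos C (X ∪ Y) := by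
  refine ⟨hX.1.mono Set.subset_union_left, ?_, ?_⟩
  · ext v
    have h₁ := Set.ext_iff.1 hX.2.1 v
    have h₂ := Set.ext_iff.1 hY.2.1 v
    simp only [Set.mem_inter_iff, Set.mem_union, Set.mem_empty_iff_false] at *
    tauto
  · rw [← Set.union_assoc]
    exact hY.2.2

theorem ValidNeg.union {C X Y : Set V} (hX : T.ValidNeg C X) (hY : T.ValidNeg (C \ X) Y) :
    T.ValidNeg C (X ∪ Y) := by
  refine ⟨hX.1.mono Set.subset_union_left,
    Set.union_subset hX.2.1 (hY.2.1.trans Set.sdiff_subset), ?_⟩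
  rw [← Set.sdiff_sdiff]
  exact hY.2.2

/-- Removing from a negative changeset the nodes that have just been fetched leaves a
negative changeset for the cache before the fetch. -/
theorem ValidNeg.diff_of_validPos {C X Y : Set V} (hC : T.Subforest C) (hX : T.ValidPos C X)
    (hY : T.ValidNeg (C ∪ X) Y) (hne : (Y \ X).Nonempty) : T.ValidNeg C (Y \ X) := by
  refine ⟨hne, fun v hv => (hY.2.1 hv.1).resolve_right hv.2, ?_⟩
  convert hC.inter hY.2.2 using 1
  ext v
  have h := Set.ext_iff.1 hX.2.1 v
  simp only [Set.mem_inter_iff, Set.mem_union, Set.mem_sdiff, Set.mem_empty_iff_false] at *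
  tauto

/-- Removing from a positive changeset the nodes that have just been evicted leaves a
positive changeset for the cache before the eviction. -/
theorem ValidPos.diff_of_validNeg {C X Y : Set V} (hC : T.Subforest C) (hX : T.ValidNeg C X)
    (hY : T.ValidPos (C \ X) Y) (hne : (Y \ X).Nonempty) : T.ValidPos C (Y \ X) := by
  refine ⟨hne, ?_, ?_⟩
  · ext v
    have h := Set.ext_iff.1 hY.2.1 v
    simp only [Set.mem_inter_iff, Set.mem_sdiff, Set.mem_empty_iff_false] at *
    tauto
  · convert hC.union hY.2.2 using 1
    ext v
    have h := @hX.2.1 v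
    simp only [Set.mem_union, Set.mem_sdiff]
    tauto

end RTree

section CntSum

variable {V : Type} [Fintype V]

theorem cntSum_union {f : V → ℕ} {A B : Set V} (h : Disjoint A B) :
    cntSum f (A ∪ B) = cntSum f A + cntSum f B := by
  simp only [cntSum, Set.indicator_union_of_disjoint h, Finset.sum_add_distrib]

theorem cntSum_mono {f g : V → ℕ} {A B : Set V}
    (h : ∀ v ∈ A, f v ≠ 0 → v ∈ B ∧ f v ≤ g v) : cntSum f A ≤ cntSum g B := by
  refine Finset.sum_le_sum fun v _ => ?_
  by_cases hA : v ∈ A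
  · by_cases h0 : f v = 0
    · simp [hA, h0]
    · obtain ⟨hB, hle⟩ := h v hA h0
      simpa [hA, hB] using hle
  · simp [hA]

/-- Incrementing the counter of at most one node increases the sum over `A` by at most `1`. -/
theorem cntSum_le_add_one {f g : V → ℕ} (w : V) (A : Set V)
    (h : ∀ v, g v ≤ f v + if v = w then 1 else 0) : cntSum g A ≤ cntSum f A + 1 := by
  calc cntSum g A ≤ ∑ v, (A.indicator f v + if v = w then 1 else 0) := by
        refine Finset.sum_le_sum fun v _ => ?_
        by_cases hA : v ∈ A
        · simpa [hA] using h v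
        · simp [hA]
    _ = cntSum f A + 1 := by
        simp [Finset.sum_add_distrib, cntSum]

end CntSum

namespace TCPhase

variable {V : Type} [Fintype V] [DecidableEq V]
  {T : RTree V} {α : ℕ} {req : ℕ → Request V}

theorem cntPost_le (E : TCPhase T α req) (t : ℕ) (v : V) : E.cntPost t v ≤ E.cnt t v := by
  unfold cntPost
  split_ifs <;> simp

theorem cnt_succ (E : TCPhase T α req) (t : ℕ) (v : V) : E.cnt (t + 1) v =
    E.cntPost t v +
      (if (req (t + 1)).1 = v ∧ Costly (req (t + 1)) (E.cache (t + 1)) then 1 else 0) :=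
  E.cnt_rec t v

/-- A node changes its state only when it belongs to the applied changeset. -/
theorem mem_chg_of_change (E : TCPhase T α req) {t : ℕ} {v : V}
    (h : ¬ (v ∈ E.cache t ↔ v ∈ E.cache (t + 1))) : ∃ X, E.chg t = some X ∧ v ∈ X := by
  rcases hX : E.chg t with _ | X
  · rw [(E.step_none t hX).1] at h
    exact (h Iff.rfl).elim
  · refine ⟨X, rfl, ?_⟩
    by_contra hv
    apply h
    rw [(E.step_some t X hX).2.2.2]
    split_ifs <;> simp [hv]

theorem mem_cache_succ_iff (E : TCPhase T α req) {t : ℕ} {v : V}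
    (h : ¬ ∃ X, E.chg t = some X ∧ v ∈ X) : v ∈ E.cache t ↔ v ∈ E.cache (t + 1) :=
  not_not.1 fun h' => h (E.mem_chg_of_change h')

/-- At time `t` no valid changeset is over-saturated, and two disjoint ones are never both
saturated. -/
def SaturationBound (E : TCPhase T α req) (t : ℕ) : Prop :=
  (∀ Y, T.Valid (E.cache t) Y → cntSum (E.cnt t) Y ≤ Y.ncard * α) ∧
  ∀ Y Z, T.Valid (E.cache t) Y → T.Valid (E.cache t) Z → Disjoint Y Z →
    cntSum (E.cnt t) Y + cntSum (E.cnt t) Z < (Y.ncard + Z.ncard) * α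

theorem SaturationBound.cntPost_lt (hα : 1 ≤ α) {E : TCPhase T α req} {t : ℕ}
    (h : E.SaturationBound t) {Y : Set V} (hY : T.Valid (E.cache (t + 1)) Y) :
    cntSum (E.cntPost t) Y < Y.ncard * α := by
  rcases hX : E.chg t with _ | X
  · obtain ⟨hc, hlt⟩ := E.step_none t hX
    rw [hc] at hY
    exact (cntSum_mono fun v hv _ => ⟨hv, E.cntPost_le t v⟩).trans_lt (hlt Y hY)
  obtain ⟨hval, hsat, hmax, hc⟩ := E.step_some t X hX
  have hle : cntSum (E.cntPost t) Y ≤ cntSum (E.cnt t) (Y \ X) := by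
    refine cntSum_mono fun v hv h0 => ⟨⟨hv, fun hvX => h0 ?_⟩, E.cntPost_le t v⟩
    unfold cntPost
    rw [if_pos ⟨X, hX, hvX⟩]
  have extension : Disjoint X Y → T.Valid (E.cache t) (X ∪ Y) →
      cntSum (E.cntPost t) Y < Y.ncard * α := by
    intro hd hXY
    obtain ⟨y, hy⟩ := hY.nonempty
    have hlt := hmax _ hXY (Set.ssubset_iff_subset_ne.2
      ⟨Set.subset_union_left, fun e => hd.notMem_of_mem_right hy (e ▸ Or.inr hy)⟩)
    rw [cntSum_union hd, Set.ncard_union_eq hd, add_mul] at hlt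
    rw [hd.symm.sdiff_eq_left] at hle
    omega
  have opposite : ((Y \ X).Nonempty → T.Valid (E.cache t) (Y \ X)) →
      cntSum (E.cntPost t) Y < Y.ncard * α := by
    intro hv
    have hpos := hY.ncard_mul_pos hα
    rcases (Y \ X).eq_empty_or_nonempty with he | hne
    · rw [he] at hle
      have : cntSum (E.cnt t) ∅ = 0 := by simp [cntSum]
      omega
    · have hlt := h.2 _ _ (hv hne) hval Set.disjoint_sdiff_left
      have hcard : (Y \ X).ncard * α ≤ Y.ncard * α :=
        Nat.mul_le_mul_right _ (Set.ncard_le_ncard Set.sdiff_subset)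
      rw [add_mul] at hlt
      omega
  have hC := E.cache_subforest t
  by_cases hpos : T.ValidPos (E.cache t) X
  · rw [if_pos hpos] at hc
    rw [hc] at hY
    rcases hY with hY' | hY'
    · refine extension ?_ (Or.inl (hpos.union hY'))
      exact (Set.disjoint_iff_inter_eq_empty.2 hY'.2.1).symm.mono_left Set.subset_union_right
    · exact opposite fun hne => Or.inr (hY'.diff_of_validPos hC hpos hne)
  · have hneg := hval.resolve_left hpos
    rw [if_neg hpos] at hc
    rw [hc] at hY
    rcases hY with hY' | hY'
    · exact opposite fun hne => Or.inl (hY'.diff_of_validNeg hC hneg hne)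
    · exact extension (Set.disjoint_of_subset_right hY'.2.1 Set.disjoint_sdiff_right)
        (Or.inr (hneg.union hY'))

theorem saturationBound (E : TCPhase T α req) (hα : 1 ≤ α) (t : ℕ) : E.SaturationBound t := by
  induction t with
  | zero =>
    have h0 : ∀ Y, cntSum (E.cnt 0) Y = 0 := fun Y => by
      simp [cntSum, Set.indicator_apply, E.cnt_zero]
    refine ⟨fun Y _ => by simp [h0], fun Y Z hY _ _ => ?_⟩
    have := hY.ncard_mul_pos hα
    rw [h0, h0, add_mul]
    omega
  | succ t ih =>
    have hstep : ∀ A, cntSum (E.cnt (t + 1)) A ≤ cntSum (E.cntPost t) A + 1 := fun A => by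
      refine cntSum_le_add_one (req (t + 1)).1 A fun v => ?_
      rw [cnt_succ]
      gcongr
      split_ifs <;> simp_all
    refine ⟨fun Y hY => (hstep Y).trans (ih.cntPost_lt hα hY), fun Y Z hY hZ hd => ?_⟩
    have h₁ := ih.cntPost_lt hα hY
    have h₂ := ih.cntPost_lt hα hZ
    have h₃ := hstep (Y ∪ Z)
    rw [cntSum_union hd, cntSum_union hd] at h₃
    rw [add_mul]
    omega

/-- The counter of a non-cached node counts only positive requests. -/
theorem cnt_le_card_pos (E : TCPhase T α req) {t : ℕ} {v : V} (hv : v ∉ E.cache t) :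
    E.cnt t v ≤ ((Finset.Icc 1 t).filter fun r => req r = (v, true)).card := by
  induction t with
  | zero => simp [E.cnt_zero]
  | succ t ih =>
    have hpost : E.cntPost t v ≤ ((Finset.Icc 1 t).filter fun r => req r = (v, true)).card := by
      unfold cntPost
      split_ifs with h
      · simp
      · exact ih fun h' => hv ((E.mem_cache_succ_iff h).1 h')
    rw [cnt_succ, ← Finset.insert_Icc_right_eq_Icc_add_one (by omega), Finset.filter_insert]
    have hreq : (req (t + 1)).1 = v ∧ Costly (req (t + 1)) (E.cache (t + 1)) →
        req (t + 1) = (v, true) := by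
      rintro ⟨rfl, h | h⟩
      · exact Prod.ext rfl h.1
      · exact (hv h.2).elim
    by_cases h : req (t + 1) = (v, true)
    · rw [if_pos h, Finset.card_insert_of_notMem (by simp)]
      split_ifs <;> omega
    · rw [if_neg h, if_neg fun h' => h (hreq h')]
      exact hpost

/-- Every slot of a node at or before a time at which the node is fetched or evicted lies
in some field up to that time. -/
theorem exists_inField (E : TCPhase T α req) {t r : ℕ} {v : V} (hr : 1 ≤ r) (hrt : r ≤ t)
    (h : ∃ X, E.chg t = some X ∧ v ∈ X) : ∃ s ≤ t, E.inField s v r := by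
  have hex : ∃ s, r ≤ s ∧ ∃ X, E.chg s = some X ∧ v ∈ X := ⟨t, hrt, h⟩
  obtain ⟨hrs, X, hX, hv⟩ := Nat.find_spec hex
  refine ⟨Nat.find hex, Nat.find_min' hex ⟨hrt, h⟩, X, hX, hv, ?_, hrs⟩
  refine (Finset.sup_lt_iff (show 0 < r from hr)).2 fun s hs => ?_
  rw [Finset.mem_filter, Finset.mem_range] at hs
  by_contra hle
  exact Nat.find_min hex hs.1 ⟨not_lt.1 hle, E.mem_chg_of_change hs.2⟩

theorem card_open_le_cnt (E : TCPhase T α req) (hgood : E.GoodReq) (t : ℕ) (v : V) :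
    ((Finset.Icc 1 t).filter fun r =>
      (req r).1 = v ∧ ∀ s, s ≤ t → ¬ E.inField s v r).card ≤ E.cnt t v := by
  induction t with
  | zero => simp
  | succ t ih =>
    have hpost : ((Finset.Icc 1 t).filter fun r =>
        (req r).1 = v ∧ ∀ s, s ≤ t → ¬ E.inField s v r).card ≤ E.cntPost t v := by
      unfold cntPost
      split_ifs with h
      · rw [Nat.le_zero, Finset.card_eq_zero, Finset.filter_eq_empty_iff]
        rintro r hr ⟨-, hopen⟩
        rw [Finset.mem_Icc] at hr
        obtain ⟨s, hs, hf⟩ := E.exists_inField hr.1 hr.2 h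
        exact hopen s hs hf
      · exact ih
    have hsub : ((Finset.Icc 1 t).filter fun r =>
        (req r).1 = v ∧ ∀ s, s ≤ t + 1 → ¬ E.inField s v r).card ≤ E.cntPost t v := by
      refine le_trans (Finset.card_le_card fun r hr => ?_) hpost
      rw [Finset.mem_filter] at hr ⊢
      exact ⟨hr.1, hr.2.1, fun s hs => hr.2.2 s (by omega)⟩
    have hcost : Costly (req (t + 1)) (E.cache (t + 1)) := by
      have := hgood (t + 1) (by omega)
      unfold Costly
      cases hb : (req (t + 1)).2 <;> simp_all
    rw [cnt_succ, ← Finset.insert_Icc_right_eq_Icc_add_one (by omega), Finset.filter_insert]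
    simp only [hcost, and_true]
    by_cases h : (req (t + 1)).1 = v
    · rw [if_pos h]
      split_ifs
      · exact (Finset.card_insert_le _ _).trans (by omega)
      · exact hsub.trans (Nat.le_add_right _ _)
    · rw [if_neg fun h' => h h'.1, if_neg h]
      exact hsub

theorem openReq_le_cntSum (E : TCPhase T α req) (hgood : E.GoodReq) (t : ℕ) :
    E.openReq t ≤ cntSum (E.cnt t) Set.univ := by
  unfold openReq cntSum
  rw [Finset.card_eq_sum_card_fiberwise (f := fun r => (req r).1) (t := Finset.univ)
    (fun _ _ => Finset.mem_coe.2 (Finset.mem_univ _))]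
  refine Finset.sum_le_sum fun v _ => ?_
  rw [Set.indicator_of_mem (Set.mem_univ v)]
  refine le_trans (Finset.card_le_card fun r hr => ?_) (E.card_open_le_cnt hgood t v)
  rw [Finset.mem_filter, Finset.mem_filter] at hr
  obtain ⟨⟨hr, hopen⟩, rfl⟩ := hr
  exact Finset.mem_filter.2 ⟨hr, rfl, hopen⟩

/-- The counters of non-cached nodes never held by the schedule `D` are paid for by the
serving cost of `D`. -/
theorem cntSum_le_serveCost (E : TCPhase T α req) {t : ℕ} (D : ℕ → Set V) {A : Set V}
    (hA : Disjoint A (E.cache t)) (hD : ∀ r ∈ Set.Icc 1 t, Disjoint A (D r)) :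
    cntSum (E.cnt t) A ≤ serveCost req D 1 t := by
  unfold serveCost cntSum
  rw [Finset.card_eq_sum_card_fiberwise (f := fun r => (req r).1) (t := Finset.univ)
    (fun _ _ => Finset.mem_coe.2 (Finset.mem_univ _))]
  refine Finset.sum_le_sum fun v _ => ?_
  by_cases hv : v ∈ A
  · rw [Set.indicator_of_mem hv]
    refine (E.cnt_le_card_pos (hA.notMem_of_mem_left hv)).trans
      (Finset.card_le_card fun r hr => ?_)
    rw [Finset.mem_filter] at hr
    simp only [Finset.mem_filter]
    refine ⟨⟨hr.1, Or.inl ?_⟩, ?_⟩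
    · rw [hr.2]
      exact ⟨rfl, (hD r (Finset.mem_Icc.1 hr.1)).notMem_of_mem_left hv⟩
    · rw [hr.2]
  · simp [hv]

end TCPhase

/-- The number of distinct nodes held by a schedule is at most its cache size plus the
number of its fetches. -/
theorem ncard_biUnion_le {V : Type} [Fintype V] {k : ℕ} {D : ℕ → Set V}
    (hD : ∀ t, (D t).ncard ≤ k) (b : ℕ) :
    (⋃ r ∈ Set.Icc 1 b, D r).ncard ≤ k + ∑ t ∈ Finset.Ico 1 b, (D (t + 1) \ D t).ncard := by
  induction b with
  | zero => simp
  | succ b ih =>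
    rcases Nat.eq_zero_or_pos b with rfl | hb
    · simpa using hD 1
    · have hsub : (⋃ r ∈ Set.Icc 1 (b + 1), D r) ⊆
          (⋃ r ∈ Set.Icc 1 b, D r) ∪ (D (b + 1) \ D b) := by
        intro v hv
        obtain ⟨r, hr, hvr⟩ := Set.mem_iUnion₂.1 hv
        rcases hr.2.lt_or_eq with hlt | rfl
        · exact Or.inl (Set.mem_biUnion (Set.mem_Icc.2 ⟨hr.1, Nat.lt_succ_iff.1 hlt⟩) hvr)
        · by_cases h : v ∈ D b
          · exact Or.inl (Set.mem_biUnion (Set.mem_Icc.2 ⟨hb, le_rfl⟩) h)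
          · exact Or.inr ⟨hvr, h⟩
      rw [Finset.sum_Ico_succ_top (show 1 ≤ b from hb)]
      have h₁ := Set.ncard_le_ncard hsub
      have h₂ := Set.ncard_union_le (⋃ r ∈ Set.Icc 1 b, D r) (D (b + 1) \ D b)
      omega

theorem exists_schedule_optCostFrom {V : Type} (T : RTree V) (α k : ℕ) (ρ : ℕ → Request V)
    (a b : ℕ) : ∃ D : ℕ → Set V, IsSchedule T k D ∧
      optCostFrom T α k ρ a b = serveCost ρ D a b + moveCost α D a b := by
  have hne : {n | ∃ D : ℕ → Set V, IsSchedule T k D ∧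
      n = serveCost ρ D a b + moveCost α D a b}.Nonempty :=
    ⟨_, fun _ => ∅, fun _ => ⟨fun v hv => hv.elim, by simp⟩, rfl⟩
  exact Nat.sInf_mem hne

/-- for any phase `P` of `TC`, `req(F^∞) ≤ 2·kONL·α + 2·OPT(P)`, where
`OPT(P)` is the optimal offline cost of serving the requests of `P` with cache size
`kOPT ≤ kONL`, starting from an arbitrary cache. -/
theorem open_field_request_bound {V : Type} [Fintype V] [DecidableEq V]
    {T : RTree V} {α : ℕ} {req : ℕ → Request V}
    (E : TCPhase T α req) (hα : 1 ≤ α) (hgood : E.GoodReq)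
    (kONL kOPT tEnd : ℕ) (hk : kOPT ≤ kONL) (hend : E.PhaseEnd kONL tEnd) :
    E.openReq tEnd ≤ 2 * kONL * α + 2 * optCostFrom T α kOPT req 1 tEnd := by
  obtain ⟨D, hD, hopt⟩ := exists_schedule_optCostFrom T α kOPT req 1 tEnd
  set C := E.cache tEnd with hC
  set W := ⋃ r ∈ Set.Icc 1 tEnd, D r with hW
  have hbound : ∀ Y, (Y.Nonempty → T.Valid C Y) → cntSum (E.cnt tEnd) Y ≤ Y.ncard * α := by
    intro Y hY
    rcases Y.eq_empty_or_nonempty with rfl | hne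
    · simp [cntSum]
    · exact (E.saturationBound hα tEnd).1 Y (hY hne)
  have hCk : C.ncard ≤ kONL := by
    rw [hC]
    rcases tEnd with _ | t
    · simp [E.cache_zero]
    · exact hend t (Nat.lt_succ_self t)
  have hcached : cntSum (E.cnt tEnd) C ≤ kONL * α :=
    (hbound C fun hne => Or.inr ⟨hne, subset_rfl, by simp [RTree.Subforest]⟩).trans
      (Nat.mul_le_mul_right _ hCk)
  have hmove : W.ncard * α ≤ kOPT * α + moveCost α D 1 tEnd := by
    have hsum : ∑ t ∈ Finset.Ico 1 tEnd, (D (t + 1) \ D t).ncard ≤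
        ∑ t ∈ Finset.Ico 1 tEnd, ((D (t + 1) \ D t).ncard + (D t \ D (t + 1)).ncard) :=
      Finset.sum_le_sum fun _ _ => Nat.le_add_right _ _
    rw [moveCost, mul_comm α, ← add_mul]
    exact Nat.mul_le_mul_right _
      ((ncard_biUnion_le (fun t => (hD t).2) tEnd).trans (Nat.add_le_add_left hsum _))
  have hheld : cntSum (E.cnt tEnd) (W \ C) ≤ W.ncard * α := by
    refine (hbound (W \ C) fun hne => Or.inl ⟨hne, Set.sdiff_inter_self, ?_⟩).trans
      (Nat.mul_le_mul_right _ (Set.ncard_le_ncard Set.sdiff_subset))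
    rw [Set.union_sdiff_self]
    exact (E.cache_subforest tEnd).union (RTree.Subforest.biUnion fun r _ => (hD r).1)
  have hrest : cntSum (E.cnt tEnd) (C ∪ W)ᶜ ≤ serveCost req D 1 tEnd := by
    have hd : Disjoint (C ∪ W)ᶜ (C ∪ W) := disjoint_compl_left
    exact E.cntSum_le_serveCost D (hd.mono_right Set.subset_union_left) fun r hr =>
      hd.mono_right ((Set.subset_biUnion_of_mem hr).trans Set.subset_union_right)
  have hsplit : cntSum (E.cnt tEnd) Set.univ = cntSum (E.cnt tEnd) C +
      cntSum (E.cnt tEnd) (W \ C) + cntSum (E.cnt tEnd) (C ∪ W)ᶜ := by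
    rw [← cntSum_union Set.disjoint_sdiff_right, Set.union_sdiff_self,
      ← cntSum_union disjoint_compl_right, Set.union_compl_self]
  have hopen := E.openReq_le_cntSum hgood tEnd
  have hkα : kOPT * α ≤ kONL * α := Nat.mul_le_mul_right _ hk
  rw [mul_assoc, hopt]
  omega
end
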